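/- arXiv:2002.10162 — 3 statements merged into one kernel-verified Lean document; each statement's English description precedes it below -/
import Mathlib

section
/- Let q be a real number with q > 0 and q ≠ 1, let x be real, let k ≥ 1, and let r_1,…,r_k be nonnegative integers, with the convention that a q-multinomial coefficient with a negative lower argument equals 0. Then [x; r_1,…,r_k]_q = q^{s_k} · [x−1; r_1,…,r_k]_q + Σ_{i=1}^{k} q^{s_{i−1}} · [x−1; r_1,…,r_{i−1}, r_i−1, r_{i+1},…,r_k]_q, where s_0 = 0 and s_j = r_1 + ⋯ + r_j for j = 1,…,k. -/
open Finset Filter Classical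

noncomputable def qNum (q x : ℝ) : ℝ := (1 - q ^ x) / (1 - q)

noncomputable def qFact (q x : ℝ) (r : ℕ) : ℝ :=
  ∏ i ∈ Finset.range r, qNum q (x - i)

noncomputable def qFactorial (q : ℝ) (r : ℕ) : ℝ :=
  ∏ i ∈ Finset.range r, qNum q (i + 1)

noncomputable def qBinom (q x : ℝ) (r : ℕ) : ℝ := qFact q x r / qFactorial q r

noncomputable def qMultinom {k : ℕ} (q x : ℝ) (r : Fin k → ℕ) : ℝ :=
  qFact q x (∑ i, r i) / ∏ i, qFactorial q (r i)

/-- `q`-multinomial coefficient allowing integer lower arguments, with the convention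
that it equals `0` if some lower argument is negative. -/
noncomputable def qMultinomZ (q x : ℝ) (k : ℕ) (r : ℕ → ℤ) : ℝ :=
  if ∀ i < k, 0 ≤ r i then
    qFact q x (∑ i ∈ Finset.range k, r i).toNat /
      ∏ i ∈ Finset.range k, qFactorial q (r i).toNat
  else 0

theorem qNum_zero (q : ℝ) : qNum q 0 = 0 := by simp [qNum]

theorem qNum_ne_zero {q x : ℝ} (hq0 : 0 < q) (hq1 : q ≠ 1) (hx : x ≠ 0) : qNum q x ≠ 0 := by
  refine div_ne_zero (sub_ne_zero.2 fun h => ?_) (sub_ne_zero.2 hq1.symm)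
  exact hx ((Real.rpow_right_inj hq0 hq1).1 (h.symm.trans (Real.rpow_zero q).symm))

theorem qNum_add {q : ℝ} (hq0 : 0 < q) (x y : ℝ) :
    qNum q (x + y) = qNum q x + q ^ x * qNum q y := by
  simp only [qNum, Real.rpow_add hq0]
  ring

theorem qNum_sum_range {q : ℝ} (hq0 : 0 < q) (a : ℕ → ℝ) (k : ℕ) :
    qNum q (∑ j ∈ Finset.range k, a j) =
      ∑ i ∈ Finset.range k, q ^ (∑ j ∈ Finset.range i, a j) * qNum q (a i) := by
  induction k with
  | zero => simp [qNum_zero]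
  | succ k ih => rw [Finset.sum_range_succ, qNum_add hq0, ih, Finset.sum_range_succ]

theorem qFact_succ (q x : ℝ) (n : ℕ) : qFact q x (n + 1) = qFact q x n * qNum q (x - n) :=
  Finset.prod_range_succ _ _

theorem qFact_succ_left (q x : ℝ) (n : ℕ) :
    qFact q x (n + 1) = qNum q x * qFact q (x - 1) n := by
  rw [qFact, Finset.prod_range_succ', mul_comm, qFact]
  congr 1
  · simp
  · refine Finset.prod_congr rfl fun i _ => ?_
    push_cast
    ring_nf

theorem qFactorial_succ (q : ℝ) (n : ℕ) :
    qFactorial q (n + 1) = qFactorial q n * qNum q (n + 1) :=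
  Finset.prod_range_succ _ _

theorem qMultinomZ_of_nonneg (q x : ℝ) {k : ℕ} {r : ℕ → ℤ} (hr : ∀ i < k, 0 ≤ r i) :
    qMultinomZ q x k r =
      qFact q x (∑ i ∈ Finset.range k, r i).toNat /
        ∏ i ∈ Finset.range k, qFactorial q (r i).toNat :=
  if_pos hr

/-- Lowering the `i`-th lower argument by one replaces the order `s` of the `q`-factorial in the
numerator by `s - 1` and multiplies by `[r i]_q`; both sides vanish when `r i = 0`. -/
theorem qMultinomZ_update_sub_one {q : ℝ} (hq0 : 0 < q) (hq1 : q ≠ 1) (x : ℝ) {k : ℕ}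
    {r : ℕ → ℤ} (hr : ∀ i < k, 0 ≤ r i) {i : ℕ} (hi : i < k) :
    qMultinomZ q x k (Function.update r i (r i - 1)) =
      qFact q x ((∑ j ∈ Finset.range k, r j).toNat - 1) /
        (∏ j ∈ Finset.range k, qFactorial q (r j).toNat) * qNum q (r i) := by
  have hmem : i ∈ Finset.range k := Finset.mem_range.2 hi
  rcases (hr i hi).eq_or_lt with h0 | hpos
  · have hneg : ¬ ∀ j < k, 0 ≤ Function.update r i (r i - 1) j := fun h => by
      have := h i hi
      rw [Function.update_self] at this
      omega
    rw [qMultinomZ, if_neg hneg, ← h0, Int.cast_zero, qNum_zero, mul_zero]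
  · have hnonneg : ∀ j < k, 0 ≤ Function.update r i (r i - 1) j := fun j hj => by
      rcases eq_or_ne j i with rfl | hne
      · rw [Function.update_self]
        omega
      · rw [Function.update_of_ne hne]
        exact hr j hj
    have hsum : (∑ j ∈ Finset.range k, Function.update r i (r i - 1) j).toNat =
        (∑ j ∈ Finset.range k, r j).toNat - 1 := by
      have h1 := Finset.sum_update_of_mem hmem r (r i - 1)
      have h2 := Finset.sum_eq_add_sum_sdiff_singleton_of_mem hmem r
      omega
    have hprod : ∏ j ∈ Finset.range k, qFactorial q (r j).toNat =
        (∏ j ∈ Finset.range k, qFactorial q (Function.update r i (r i - 1) j).toNat) *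
          qNum q (r i) := by
      rw [← Finset.mul_prod_erase _ _ hmem, ← Finset.mul_prod_erase _ _ hmem,
        Function.update_self]
      have hcongr : ∏ j ∈ (Finset.range k).erase i,
          qFactorial q (Function.update r i (r i - 1) j).toNat =
            ∏ j ∈ (Finset.range k).erase i, qFactorial q (r j).toNat :=
        Finset.prod_congr rfl fun j hj => by
          rw [Function.update_of_ne (Finset.ne_of_mem_erase hj)]
      obtain ⟨n, hn⟩ : ∃ n : ℕ, r i = n + 1 := ⟨(r i - 1).toNat, by omega⟩
      have h1 : (r i).toNat = n + 1 := by omega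
      have h2 : (r i - 1).toNat = n := by omega
      rw [hcongr, h1, h2, qFactorial_succ, hn]
      push_cast
      ring
    have hne : qNum q (r i) ≠ 0 := qNum_ne_zero hq0 hq1 (by exact_mod_cast hpos.ne')
    rw [qMultinomZ_of_nonneg q x hnonneg, hsum, hprod, div_mul_eq_mul_div,
      mul_div_mul_right _ _ hne]

/-- Recurrence relation (2.4) for the `q`-multinomial coefficients:
`[x; r₁,…,r_k]_q = q^{s_k} [x−1; r₁,…,r_k]_q + ∑_{i=1}^{k} q^{s_{i−1}} [x−1; …, r_i−1, …]_q`,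
where `s_0 = 0` and `s_j = r₁ + ⋯ + r_j`. -/
theorem qMultinom_recurrence_second
    (q : ℝ) (hq0 : 0 < q) (hq1 : q ≠ 1) (x : ℝ) (k : ℕ) (hk : 1 ≤ k)
    (r : ℕ → ℤ) (hr : ∀ i < k, 0 ≤ r i) :
    qMultinomZ q x k r =
      q ^ ((∑ j ∈ Finset.range k, (r j : ℝ))) * qMultinomZ q (x - 1) k r +
        ∑ i ∈ Finset.range k,
          q ^ (∑ j ∈ Finset.range i, (r j : ℝ)) *
            qMultinomZ q (x - 1) k (Function.update r i (r i - 1)) := by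
  have hterm : ∀ i ∈ Finset.range k,
      q ^ (∑ j ∈ Finset.range i, (r j : ℝ)) *
          qMultinomZ q (x - 1) k (Function.update r i (r i - 1)) =
        qFact q (x - 1) ((∑ j ∈ Finset.range k, r j).toNat - 1) /
          (∏ j ∈ Finset.range k, qFactorial q (r j).toNat) *
            (q ^ (∑ j ∈ Finset.range i, (r j : ℝ)) * qNum q (r i)) := fun i hi => by
    rw [qMultinomZ_update_sub_one hq0 hq1 (x - 1) hr (Finset.mem_range.1 hi), mul_left_comm]
  rw [Finset.sum_congr rfl hterm, ← Finset.mul_sum, ← qNum_sum_range hq0, qMultinomZ_of_nonneg q x hr,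
    qMultinomZ_of_nonneg q (x - 1) hr, ← Int.cast_sum]
  obtain ⟨s, hs⟩ := Int.eq_ofNat_of_zero_le
    (Finset.sum_nonneg fun i hi => hr i (Finset.mem_range.1 hi))
  rw [hs, Int.toNat_natCast, Int.cast_natCast]
  cases s with
  | zero => simp [qFact, qNum_zero]
  | succ n =>
    have hx : qNum q x = qNum q (n + 1) + q ^ ((n : ℝ) + 1) * qNum q (x - 1 - n) := by
      rw [← qNum_add hq0]
      ring_nf
    rw [qFact_succ_left, qFact_succ, hx, Nat.add_sub_cancel]
    push_cast
    ring
end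

section
/- (Second multivariate q-Cauchy formula, probabilistic form.) Let k ≥ 1, and let r, n, x_1,…,x_{k+1} be nonnegative integers with x_1+⋯+x_{k+1} = n and n ≤ r; let q > 0 be real with q ≠ 1. Then [r+k; n+k]_q = Σ q^{Σ_{j=1}^{k}(x_j+1)(r−n−s_j+y_j)} · ∏_{j=1}^{k+1}[r_j; x_j]_q, where y_j = x_1+⋯+x_j, s_j = r_1+⋯+r_j, the sum is over all integers r_1,…,r_k with x_j ≤ r_j ≤ r and r_1+⋯+r_k ≤ r, and r_{k+1} = r − s_k. -/
open Finset Filter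

lemma qNum_natCast_add_one_ne_zero {q : ℝ} (hq0 : 0 < q) (hq1 : q ≠ 1) (m : ℕ) :
    qNum q ((m : ℝ) + 1) ≠ 0 := by
  have hpow : q ^ (m + 1) ≠ 1 := fun h =>
    hq1 ((pow_eq_one_iff_of_nonneg hq0.le (Nat.succ_ne_zero m)).1 h)
  unfold qNum
  rw [← Nat.cast_succ, Real.rpow_natCast]
  exact div_ne_zero (sub_ne_zero.2 hpow.symm) (sub_ne_zero.2 hq1.symm)

lemma qFactorial_ne_zero {q : ℝ} (hq0 : 0 < q) (hq1 : q ≠ 1) (m : ℕ) :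
    qFactorial q m ≠ 0 :=
  Finset.prod_ne_zero_iff.2 fun i _ => qNum_natCast_add_one_ne_zero hq0 hq1 i

lemma qNum_add_one_eq {q : ℝ} (hq0 : 0 < q) (x : ℝ) (m : ℕ) :
    qNum q (x + 1) = qNum q ((m : ℝ) + 1) + q ^ (m + 1) * qNum q (x - m) := by
  have h : q ^ (x + 1) = q ^ (m + 1) * q ^ (x - m) := by
    rw [← Real.rpow_natCast, ← Real.rpow_add hq0]
    congr 1
    push_cast
    ring
  have h' : q ^ ((m : ℝ) + 1) = q ^ (m + 1) := by
    rw [← Nat.cast_succ, Real.rpow_natCast]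
  unfold qNum
  rw [h, h']
  ring

lemma qFact_add_one_succ (q x : ℝ) (m : ℕ) :
    qFact q (x + 1) (m + 1) = qFact q x m * qNum q (x + 1) := by
  unfold qFact
  rw [Finset.prod_range_succ']
  simp

@[simp] lemma qBinom_zero_right (q x : ℝ) : qBinom q x 0 = 1 := by
  simp [qBinom, qFact, qFactorial]

lemma qBinom_add_one_succ {q : ℝ} (hq0 : 0 < q) (hq1 : q ≠ 1) (x : ℝ) (m : ℕ) :
    qBinom q (x + 1) (m + 1) = qBinom q x m + q ^ (m + 1) * qBinom q x (m + 1) := by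
  have h1 := qFactorial_ne_zero hq0 hq1 m
  have h2 := qNum_natCast_add_one_ne_zero hq0 hq1 m
  have h3 : qFactorial q (m + 1) = qFactorial q m * qNum q ((m : ℝ) + 1) :=
    Finset.prod_range_succ _ _
  have h4 : qFact q x (m + 1) = qFact q x m * qNum q (x - m) := Finset.prod_range_succ _ _
  unfold qBinom
  rw [qFact_add_one_succ, h3, h4, qNum_add_one_eq hq0 x m]
  field_simp

lemma qBinom_natCast_eq_zero (q : ℝ) {a b : ℕ} (h : a < b) : qBinom q (a : ℝ) b = 0 := by
  have : qFact q (a : ℝ) b = 0 :=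
    Finset.prod_eq_zero (Finset.mem_range.2 h) (by simp [qNum])
  simp [qBinom, this]

/-- The `q`-Vandermonde convolution in the upper index. -/
lemma sum_range_qBinom_mul_qBinom {q : ℝ} (hq0 : 0 < q) (hq1 : q ≠ 1) (a r b : ℕ) :
    ∑ v ∈ Finset.range (r + 1), q ^ (((a : ℤ) + 1) * (((r - v : ℕ) : ℤ) - b)) *
        (qBinom q (v : ℝ) a * qBinom q ((r - v : ℕ) : ℝ) b) =
      qBinom q ((r : ℝ) + 1) (a + b + 1) := by
  have hq : q ≠ 0 := hq0.ne'
  induction r generalizing b with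
  | zero =>
    rcases Nat.eq_zero_or_pos (a + b) with h | h
    · obtain ⟨rfl, rfl⟩ : a = 0 ∧ b = 0 := by omega
      have := qBinom_add_one_succ hq0 hq1 ((0 : ℕ) : ℝ) 0
      rw [qBinom_natCast_eq_zero q (show 0 < 0 + 1 from zero_lt_one)] at this
      simpa using this.symm
    · have h0 : qBinom q ((0 : ℕ) : ℝ) a * qBinom q ((0 : ℕ) : ℝ) b = 0 := by
        rcases Nat.eq_zero_or_pos a with ha | ha
        · rw [qBinom_natCast_eq_zero q (show 0 < b by omega), mul_zero]
        · rw [qBinom_natCast_eq_zero q ha, zero_mul]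
      have h1 := qBinom_natCast_eq_zero q (show 1 < a + b + 1 by omega)
      rw [Finset.sum_range_one, Nat.sub_zero, h0, mul_zero]
      simpa using h1.symm
  | succ r ih =>
    rw [Finset.sum_range_succ, Nat.sub_self, Nat.cast_succ r, qBinom_add_one_succ hq0 hq1]
    cases b with
    | zero =>
      rw [Nat.add_zero, ← Nat.add_zero a, ← ih 0, Finset.mul_sum, add_comm]
      congr 1
      · simp
      · refine Finset.sum_congr rfl fun v hv => ?_
        have hv' : r + 1 - v = (r - v) + 1 := by have := Finset.mem_range.1 hv; omega
        have he : ((a : ℤ) + 1) * (((r - v + 1 : ℕ) : ℤ) - (0 : ℕ)) =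
            ((a + 1 : ℕ) : ℤ) + ((a : ℤ) + 1) * (((r - v : ℕ) : ℤ) - (0 : ℕ)) := by
          push_cast; ring
        rw [Nat.add_zero, hv', he, zpow_add₀ hq, zpow_natCast]
        simp only [qBinom_zero_right]
        ring
    | succ b =>
      rw [qBinom_natCast_eq_zero q (Nat.succ_pos b), mul_zero, mul_zero, add_zero,
        ← add_assoc a b 1, ← ih b, add_assoc a b 1, ← ih (b + 1), Finset.mul_sum,
        ← Finset.sum_add_distrib]
      refine Finset.sum_congr rfl fun v hv => ?_
      have hv' : r + 1 - v = (r - v) + 1 := by have := Finset.mem_range.1 hv; omega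
      have he : ((a : ℤ) + 1) * (((r - v + 1 : ℕ) : ℤ) - (b + 1 : ℕ)) =
          ((a : ℤ) + 1) * (((r - v : ℕ) : ℤ) - b) := by
        push_cast; ring
      have he' : ((a : ℤ) + 1) * (((r - v : ℕ) : ℤ) - b) =
          ((a + 1 : ℕ) : ℤ) + ((a : ℤ) + 1) * (((r - v : ℕ) : ℤ) - (b + 1 : ℕ)) := by
        push_cast; ring
      rw [hv', he, Nat.cast_succ (r - v), qBinom_add_one_succ hq0 hq1, he', zpow_add₀ hq,
        zpow_natCast]
      ring

lemma sum_filter_val_le_succ {M : Type*} [AddCommMonoid M] {k : ℕ} (f : Fin (k + 1) → M)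
    (m : ℕ) :
    ∑ i ∈ Finset.univ.filter (fun i : Fin (k + 1) => (i : ℕ) ≤ m + 1), f i =
      f 0 + ∑ i ∈ Finset.univ.filter (fun i : Fin k => (i : ℕ) ≤ m), f i.succ := by
  simp [Finset.sum_filter, Fin.sum_univ_succ]

lemma sum_filter_val_le_zero {M : Type*} [AddCommMonoid M] {k m : ℕ} (f : Fin (k + 1) → M) :
    ∑ i ∈ Finset.univ.filter (fun i : Fin (k + 1) => (i : ℕ) ≤ ((0 : Fin (m + 1)) : ℕ)), f i =
      f 0 := by
  simp [Finset.sum_filter]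

/-- A sum over bounded tuples with bounded total splits off its first coordinate. -/
lemma sum_piFinset_Icc_filter_succ {M : Type*} [AddCommMonoid M] {k : ℕ} (r : ℕ)
    (l : Fin (k + 1) → ℕ) (f : (Fin (k + 1) → ℕ) → M) :
    ∑ v ∈ (Fintype.piFinset fun j => Finset.Icc (l j) r).filter (fun v => ∑ i, v i ≤ r), f v =
      ∑ a ∈ Finset.Icc (l 0) r,
        ∑ w ∈ (Fintype.piFinset fun j : Fin k => Finset.Icc (l j.succ) (r - a)).filter
          (fun w => ∑ i, w i ≤ r - a), f (Fin.cons a w) := by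
  rw [Finset.sum_sigma']
  refine Finset.sum_nbij' (fun v => ⟨v 0, Fin.tail v⟩) (fun p => Fin.cons p.1 p.2) ?_ ?_ ?_ ?_ ?_
  · intro v hv
    simp only [Finset.mem_filter, Fintype.mem_piFinset, Finset.mem_Icc, Fin.sum_univ_succ] at hv
    obtain ⟨hb, hs⟩ := hv
    simp only [Finset.mem_sigma, Finset.mem_filter, Fintype.mem_piFinset, Finset.mem_Icc,
      Fin.tail]
    refine ⟨hb 0, fun j => ⟨(hb j.succ).1, ?_⟩, by omega⟩
    have := Finset.single_le_sum (f := fun i : Fin k => v i.succ) (fun i _ => Nat.zero_le _)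
      (Finset.mem_univ j)
    omega
  · rintro ⟨a, w⟩ hp
    simp only [Finset.mem_sigma, Finset.mem_filter, Fintype.mem_piFinset, Finset.mem_Icc] at hp
    obtain ⟨ha, hb, hs⟩ := hp
    simp only [Finset.mem_filter, Fintype.mem_piFinset, Finset.mem_Icc, Fin.sum_univ_succ,
      Fin.cons_zero, Fin.cons_succ, Fin.forall_fin_succ]
    exact ⟨⟨ha, fun j => ⟨(hb j).1, (hb j).2.trans (Nat.sub_le _ _)⟩⟩, by omega⟩
  · intro v _
    exact Fin.cons_self_tail v
  · rintro ⟨a, w⟩ _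
    simp
  · intro v _
    simp

/-- The second multivariate `q`-Cauchy formula, without restriction on the size of the parts. -/
lemma qBinom_add_eq_sum_prod_qBinom {q : ℝ} (hq0 : 0 < q) (hq1 : q ≠ 1)
    (k r : ℕ) (x : Fin (k + 1) → ℕ) :
    qBinom q ((r : ℝ) + k) (∑ j, x j + k) =
      ∑ v ∈ (Fintype.piFinset fun j : Fin k => Finset.Icc (x j.castSucc) r).filter
          (fun v => ∑ i, v i ≤ r),
        q ^ (∑ j : Fin k,
              ((x j.castSucc : ℤ) + 1) *
                ((r : ℤ) - ((∑ j, x j : ℕ) : ℤ) -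
                    (∑ i ∈ Finset.univ.filter (fun i : Fin k => (i : ℕ) ≤ (j : ℕ)), (v i : ℤ)) +
                  (∑ i ∈ Finset.univ.filter (fun i : Fin (k + 1) => (i : ℕ) ≤ (j : ℕ)),
                    (x i : ℤ)))) *
          ((∏ j : Fin k, qBinom q (v j : ℝ) (x j.castSucc)) *
            qBinom q ((r - ∑ i, v i : ℕ) : ℝ) (x (Fin.last k))) := by
  have hq : q ≠ 0 := hq0.ne'
  induction k generalizing r with
  | zero => simp
  | succ k ih =>
    rw [sum_piFinset_Icc_filter_succ r (fun j : Fin (k + 1) => x j.castSucc)]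
    have hsum : ∑ j, x j = x 0 + ∑ j : Fin (k + 1), x j.succ := Fin.sum_univ_succ x
    set b := ∑ j : Fin (k + 1), x j.succ with hb
    have key := sum_range_qBinom_mul_qBinom hq0 hq1 (x 0) (r + k) (b + k)
    have hL : qBinom q ((r : ℝ) + (k + 1 : ℕ)) (∑ j, x j + (k + 1)) =
        qBinom q (((r + k : ℕ) : ℝ) + 1) (x 0 + (b + k) + 1) := by
      rw [hsum]
      push_cast
      congr 1 <;> ring
    rw [hL, ← key]
    have hsub : Finset.Icc (x 0) r ⊆ Finset.range (r + k + 1) := fun a ha => by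
      have := Finset.mem_Icc.1 ha
      exact Finset.mem_range.2 (by omega)
    rw [← Finset.sum_subset hsub]
    · refine Finset.sum_congr rfl fun a ha => ?_
      have har : a ≤ r := (Finset.mem_Icc.1 ha).2
      have hc : ((r + k - a : ℕ) : ℝ) = ((r - a : ℕ) : ℝ) + k := by
        rw [← Nat.cast_add]; congr 1; omega
      rw [hc, hb, ih (r - a) (fun j => x j.succ), ← hb, Finset.mul_sum, Finset.mul_sum]
      refine Finset.sum_congr (by simp only [Fin.succ_castSucc]) fun w _ => ?_
      have hs : r - ∑ i, (Fin.cons a w : Fin (k + 1) → ℕ) i = r - a - ∑ i, w i := by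
        rw [Fin.sum_cons]; omega
      have hz : ((r - a : ℕ) : ℤ) = r - a := by omega
      have hz' : ((r + k - a : ℕ) : ℤ) = r + k - a := by omega
      rw [hs, Fin.prod_univ_succ, Fin.sum_univ_succ]
      simp only [Fin.val_succ, sum_filter_val_le_succ, sum_filter_val_le_zero,
        Fin.cons_zero, Fin.cons_succ, Fin.castSucc_zero, ← Fin.succ_castSucc, Fin.succ_last,
        hsum, hz, hz']
      rw [zpow_add₀ hq]
      have he1 : ((x 0 : ℤ) + 1) * ((r : ℤ) + k - a - ((b + k : ℕ) : ℤ)) =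
          ((x 0 : ℤ) + 1) * ((r : ℤ) - ((x 0 + b : ℕ) : ℤ) - a + x 0) := by
        push_cast; ring
      have he2 : ∀ s t : ℤ, (r : ℤ) - a - (b : ℤ) - s + t =
          (r : ℤ) - ((x 0 + b : ℕ) : ℤ) - (a + s) + (x 0 + t) := by
        intro s t; push_cast; ring
      simp only [he1, he2]
      ring
    · intro a ha hna
      have hlt := Finset.mem_range.1 ha
      rw [Finset.mem_Icc, not_and_or] at hna
      rcases hna with h | h
      · rw [qBinom_natCast_eq_zero q (not_le.1 h), zero_mul, mul_zero]
      · rw [qBinom_natCast_eq_zero q (show r + k - a < b + k by omega), mul_zero, mul_zero]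

/-- Second multivariate `q`-Cauchy formula, probabilistic form (2.10b):
`[r+k; n+k]_q = ∑ q^{∑_{j=1}^{k}(x_j+1)(r−n−s_j+y_j)} ∏_{j=1}^{k+1}[r_j; x_j]_q`,
where `y_j = x₁+⋯+x_j`, `s_j = r₁+⋯+r_j`, the sum is over integers `r₁,…,r_k` with
`x_j ≤ r_j ≤ r` and `r₁+⋯+r_k ≤ r`, and `r_{k+1} = r − s_k`. -/
theorem multivariate_qCauchy_probabilistic_second
    (k : ℕ) (hk : 1 ≤ k) (r n : ℕ) (x : Fin (k + 1) → ℕ)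
    (hx : ∑ j, x j = n) (hnr : n ≤ r)
    (q : ℝ) (hq0 : 0 < q) (hq1 : q ≠ 1) :
    qBinom q ((r : ℝ) + k) (n + k) =
      ∑ v ∈ (Fintype.piFinset fun j : Fin k => Finset.Icc (x j.castSucc) r).filter
          (fun v => ∑ i, v i ≤ r),
        q ^ (∑ j : Fin k,
              ((x j.castSucc : ℤ) + 1) *
                ((r : ℤ) - (n : ℤ) -
                    (∑ i ∈ Finset.univ.filter (fun i : Fin k => (i : ℕ) ≤ (j : ℕ)), (v i : ℤ)) +
                  (∑ i ∈ Finset.univ.filter (fun i : Fin (k + 1) => (i : ℕ) ≤ (j : ℕ)),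
                    (x i : ℤ)))) *
          ((∏ j : Fin k, qBinom q (v j : ℝ) (x j.castSucc)) *
            qBinom q ((r - ∑ i, v i : ℕ) : ℝ) (x (Fin.last k))) := by
  subst hx
  exact qBinom_add_eq_sum_prod_qBinom hq0 hq1 k r x
end

section
/- (Limit of the multivariate inverse q-Pólya distribution, case 0 < q < 1.) Let 0 < q < 1, let m be a nonzero integer, let k ≥ 1 and n ≥ 1 be integers, and fix nonnegative integers w_1,…,w_k with u_j = w_1+⋯+w_j. Let r_1(t),…,r_{k+1}(t) be sequences of positive integers (t ∈ ℕ), put r(t) = Σ_{j=1}^{k+1} r_j(t) and s_j(t) = r_1(t)+⋯+r_j(t) (s_0(t)=0), and assume: (i) r(t) − s_j(t) → ∞ as t → ∞ for each j = 0,1,…,k; (ii) [r(t)−s_j(t)]_{q^{−1}} / [r(t)−s_{j−1}(t)]_{q^{−1}} → θ_j as t → ∞, for j = 1,…,k, where either m > 0 and 0 < θ_j < 1 for all j, or m < 0 and 0 < θ_j < q^{−m(n−1)} for all j. Then the k-variate inverse q-Pólya probability function P(w_1,…,w_k) built from (r_1(t),…,r_{k+1}(t)), m, q converges, as t → ∞,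 to [n+u_k−1; w_1,…,w_k]_{q^m} · ∏_{j=1}^{k} θ_j^{n+u_k−u_j} q^{m w_j} ∏_{i=1}^{w_j}(1 − θ_j q^{m(i−1)}). -/
open Finset Filter

theorem qNum_inv {p : ℝ} (hp : 0 < p) (hp1 : p ≠ 1) (x : ℝ) :
    qNum p⁻¹ x = p ^ (1 - x) * qNum p x := by
  have h1 : 1 - p ≠ 0 := sub_ne_zero.mpr hp1.symm
  have h2 : p - 1 ≠ 0 := sub_ne_zero.mpr hp1
  have hx : p ^ x ≠ 0 := (Real.rpow_pos_of_pos hp x).ne'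
  have h3 : 1 - p⁻¹ = (p - 1) / p := by field_simp
  unfold qNum
  rw [Real.inv_rpow hp.le, Real.rpow_sub hp, Real.rpow_one, h3]
  field_simp
  ring

theorem sum_range_natCast_real (r : ℕ) :
    ∑ i ∈ Finset.range r, (i : ℝ) = (r : ℝ) * (r - 1) / 2 := by
  induction r with
  | zero => simp
  | succ r ih => rw [Finset.sum_range_succ, ih]; push_cast; ring

theorem qFact_inv {p : ℝ} (hp : 0 < p) (hp1 : p ≠ 1) (x : ℝ) (r : ℕ) :
    qFact p⁻¹ x r = p ^ ((r : ℝ) * (1 - x) + r * (r - 1) / 2) * qFact p x r := by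
  unfold qFact
  simp_rw [qNum_inv hp hp1]
  rw [Finset.prod_mul_distrib, ← Real.rpow_sum_of_pos hp]
  congr 2
  rw [← sum_range_natCast_real, Finset.sum_congr rfl (fun (i : ℕ) _ => show
    1 - (x - (i : ℝ)) = (1 - x) + i by ring), Finset.sum_add_distrib]
  simp [mul_sub]

theorem qFactorial_inv {p : ℝ} (hp : 0 < p) (hp1 : p ≠ 1) (r : ℕ) :
    qFactorial p⁻¹ r = p ^ (-((r : ℝ) * (r - 1) / 2)) * qFactorial p r := by
  unfold qFactorial
  simp_rw [qNum_inv hp hp1]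
  rw [Finset.prod_mul_distrib, ← Real.rpow_sum_of_pos hp]
  congr 2
  rw [← sum_range_natCast_real, ← Finset.sum_neg_distrib]
  exact Finset.sum_congr rfl fun i _ => by ring

theorem sum_mul_partialSum {k : ℕ} (w : Fin k → ℝ) :
    ∑ j, w j * ∑ i ∈ Finset.univ.filter (fun i : Fin k => (i : ℕ) ≤ (j : ℕ)), w i =
      ((∑ j, w j) ^ 2 + ∑ j, w j ^ 2) / 2 := by
  have h1 : ∑ j, w j * ∑ i ∈ Finset.univ.filter (fun i : Fin k => (i : ℕ) ≤ (j : ℕ)), w i =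
      ∑ j, ∑ i, if i ≤ j then w j * w i else 0 := by
    simp_rw [Finset.sum_filter, Finset.mul_sum, mul_ite, mul_zero, Fin.val_fin_le]
  have h2 : ∑ j, ∑ i, (if i ≤ j then w j * w i else 0) =
      ∑ j, ∑ i, if j ≤ i then w j * w i else 0 := by
    rw [Finset.sum_comm]
    simp_rw [mul_comm]
  have h3 : ∑ j, ∑ i, (if i ≤ j then w j * w i else 0) +
      ∑ j, ∑ i, (if j ≤ i then w j * w i else 0) = (∑ j, w j) ^ 2 + ∑ j, w j ^ 2 := by
    have hd : ∑ j, w j ^ 2 = ∑ j, ∑ i, if j = i then w j * w i else 0 := by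
      simp [pow_two]
    rw [hd, pow_two, Finset.sum_mul_sum, ← Finset.sum_add_distrib, ← Finset.sum_add_distrib]
    refine Finset.sum_congr rfl fun j _ => ?_
    rw [← Finset.sum_add_distrib, ← Finset.sum_add_distrib]
    refine Finset.sum_congr rfl fun i _ => ?_
    rcases lt_trichotomy i j with h | h | h
    · simp [h.le, h.not_ge, h.ne']
    · simp [h]
    · simp [h.le, h.not_ge, h.ne]
  rw [h1]
  linarith

theorem qMultinom_inv {k : ℕ} {p : ℝ} (hp : 0 < p) (hp1 : p ≠ 1) (n : ℕ) (w : Fin k → ℕ) :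
    qMultinom p⁻¹ ((n : ℝ) + (∑ i, w i) - 1) w =
      p ^ (∑ j, (w j : ℝ) * (1 - ((n : ℝ) + (∑ i, w i) -
        ∑ i ∈ Finset.univ.filter (fun i : Fin k => (i : ℕ) ≤ (j : ℕ)), (w i : ℝ)))) *
      qMultinom p ((n : ℝ) + (∑ i, w i) - 1) w := by
  unfold qMultinom
  simp_rw [qFactorial_inv hp hp1]
  rw [qFact_inv hp hp1, Finset.prod_mul_distrib, ← Real.rpow_sum_of_pos hp, mul_div_mul_comm,
    ← Real.rpow_sub hp]
  congr 2
  have h := sum_mul_partialSum (fun i => (w i : ℝ))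
  have h1 : ∑ j, (w j : ℝ) * (1 - ((n : ℝ) + (∑ i, w i) -
        ∑ i ∈ Finset.univ.filter (fun i : Fin k => (i : ℕ) ≤ (j : ℕ)), (w i : ℝ))) =
      (∑ j, (w j : ℝ)) * (1 - n - ∑ i, (w i : ℝ)) +
      ∑ j, (w j : ℝ) * ∑ i ∈ Finset.univ.filter (fun i : Fin k => (i : ℕ) ≤ (j : ℕ)), (w i : ℝ) := by
    rw [Finset.sum_mul, ← Finset.sum_add_distrib]
    refine Finset.sum_congr rfl fun j _ => ?_
    push_cast
    ring
  have h2 : ∑ j, -((w j : ℝ) * (w j - 1) / 2) = (∑ j, (w j : ℝ)) / 2 - (∑ j, (w j : ℝ) ^ 2) / 2 := by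
    rw [Finset.sum_div, Finset.sum_div, ← Finset.sum_sub_distrib]
    exact Finset.sum_congr rfl fun j _ => by ring
  rw [h1, h2, h]
  push_cast
  ring

theorem zpow_neg_rpow {q : ℝ} (hq : 0 < q) {m : ℤ} (hm : m ≠ 0) (c i : ℕ) :
    (q ^ (-m)) ^ (-(c : ℝ) / (m : ℝ) - i) = q ^ c * q ^ (m * (i : ℤ)) := by
  have hm' : (m : ℝ) ≠ 0 := Int.cast_ne_zero.mpr hm
  rw [← Real.rpow_intCast, ← Real.rpow_mul hq.le, ← Real.rpow_natCast q c, ← Real.rpow_intCast,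
    ← Real.rpow_add hq]
  congr 1
  push_cast
  field_simp
  ring

theorem tendsto_qFact {q : ℝ} (hq : 0 < q) {m : ℤ} (hm : m ≠ 0) {c : ℕ → ℕ} {x : ℝ}
    (hc : Tendsto (fun t => q ^ c t) atTop (nhds x)) (l : ℕ) :
    Tendsto (fun t => qFact (q ^ (-m)) (-(c t : ℝ) / (m : ℝ)) l) atTop
      (nhds ((∏ i ∈ Finset.range l, (1 - x * q ^ (m * (i : ℤ)))) / (1 - q ^ (-m)) ^ l)) := by
  unfold qFact qNum
  simp_rw [zpow_neg_rpow hq hm, Finset.prod_div_distrib, Finset.prod_const, Finset.card_range]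
  exact (tendsto_finsetProd _ fun i _ => tendsto_const_nhds.sub (hc.mul_const _)).div_const _

theorem tendsto_pow_of_tendsto_qNum_ratio {q : ℝ} (hq0 : 0 < q) (hq1 : q < 1) {a b c : ℕ → ℕ}
    (hbac : ∀ t, b t = a t + c t) (ha : Tendsto a atTop atTop) (hb : Tendsto b atTop atTop)
    {x : ℝ} (h : Tendsto (fun t => qNum q⁻¹ (a t) / qNum q⁻¹ (b t)) atTop (nhds x)) :
    Tendsto (fun t => q ^ c t) atTop (nhds x) := by
  have hpow := tendsto_pow_atTop_nhds_zero_of_lt_one hq0.le hq1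
  have hlim : Tendsto (fun t => qNum q⁻¹ (a t) / qNum q⁻¹ (b t) * ((1 - q ^ b t) / (1 - q ^ a t)))
      atTop (nhds (x * ((1 - 0) / (1 - 0)))) :=
    h.mul (((hpow.comp hb).const_sub 1).div ((hpow.comp ha).const_sub 1) (by norm_num))
  rw [sub_zero, div_one, mul_one] at hlim
  refine hlim.congr' ?_
  filter_upwards [ha.eventually_ge_atTop 1] with t hat
  have hbt : b t ≠ 0 := by have := hbac t; omega
  have ha1 : 1 - q ^ a t ≠ 0 := (sub_pos.mpr (pow_lt_one₀ hq0.le hq1 (by omega))).ne'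
  have hb1 : 1 - q ^ b t ≠ 0 := (sub_pos.mpr (pow_lt_one₀ hq0.le hq1 hbt)).ne'
  have hqinv : 1 - q⁻¹ ≠ 0 := (sub_neg.mpr ((one_lt_inv₀ hq0).mpr hq1)).ne
  have hqa : q ^ a t ≠ 0 := (pow_pos hq0 _).ne'
  have hqb : q ^ b t ≠ 0 := (pow_pos hq0 _).ne'
  have hea : 1 - (q ^ a t)⁻¹ = -(1 - q ^ a t) / q ^ a t := by field_simp; ring
  have heb : 1 - (q ^ b t)⁻¹ = -(1 - q ^ b t) / q ^ b t := by field_simp; ring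
  unfold qNum
  rw [Real.rpow_natCast, Real.rpow_natCast, inv_pow, inv_pow, hea, heb,
    div_div_div_cancel_right₀ hqinv]
  field_simp
  rw [hbac t, pow_add]

theorem sum_sub_sum_filter_lt {k : ℕ} (f : Fin k → ℕ) (l : ℕ) :
    ∑ i, f i - ∑ i ∈ Finset.univ.filter (fun i : Fin k => (i : ℕ) < l), f i =
      ∑ i ∈ Finset.univ.filter (fun i : Fin k => l ≤ (i : ℕ)), f i := by
  rw [← Finset.sum_filter_add_sum_filter_not Finset.univ (fun i : Fin k => (i : ℕ) < l) f,
    Nat.add_sub_cancel_left]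
  simp_rw [not_lt]

theorem sum_filter_le_eq_succ {k : ℕ} (f : Fin k → ℕ) (j : Fin k) :
    ∑ i ∈ Finset.univ.filter (fun i : Fin k => (j : ℕ) ≤ (i : ℕ)), f i =
      ∑ i ∈ Finset.univ.filter (fun i : Fin k => (j : ℕ) + 1 ≤ (i : ℕ)), f i + f j := by
  have h : Finset.univ.filter (fun i : Fin k => (j : ℕ) ≤ (i : ℕ)) =
      insert j (Finset.univ.filter (fun i : Fin k => (j : ℕ) + 1 ≤ (i : ℕ))) := by
    ext i
    simp only [Finset.mem_filter, Finset.mem_univ, true_and, Finset.mem_insert, Fin.ext_iff]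
    omega
  rw [h, Finset.sum_insert (by simp), add_comm]

/-- Limit of the multivariate inverse `q`-Pólya distribution for `0 < q < 1`
(Theorem 4.2, first case): if `r(t) − s_j(t) → ∞` and
`[r(t)−s_j(t)]_{q⁻¹}/[r(t)−s_{j−1}(t)]_{q⁻¹} → θ_j`, then
`P(w₁,…,w_k) → [n+u_k−1; w₁,…,w_k]_{q^m} ∏_{j=1}^{k} θ_j^{n+u_k−u_j} q^{m w_j}
∏_{i=1}^{w_j}(1−θ_j q^{m(i−1)})`, a negative `q`-multinomial distribution. -/
theorem multivariate_inverse_qPolya_limit_q_lt_one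
    (q : ℝ) (hq0 : 0 < q) (hq1 : q < 1)
    (m : ℤ) (hm : m ≠ 0) (k n : ℕ) (hk : 1 ≤ k) (hn : 1 ≤ n)
    (w : Fin k → ℕ)
    (r : ℕ → Fin (k + 1) → ℕ) (hrpos : ∀ t j, 0 < r t j)
    (θ : Fin k → ℝ)
    (hinf : ∀ jv : ℕ, jv ≤ k →
      Filter.Tendsto
        (fun t => (∑ j, r t j) -
          ∑ i ∈ Finset.univ.filter (fun i : Fin (k + 1) => (i : ℕ) < jv), r t i)
        Filter.atTop Filter.atTop)
    (hθ : ∀ j : Fin k,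
      Filter.Tendsto
        (fun t =>
          qNum q⁻¹ ((((∑ i, r t i) -
              ∑ i ∈ Finset.univ.filter (fun i : Fin (k + 1) => (i : ℕ) < (j : ℕ) + 1),
                r t i : ℕ) : ℝ)) /
          qNum q⁻¹ ((((∑ i, r t i) -
              ∑ i ∈ Finset.univ.filter (fun i : Fin (k + 1) => (i : ℕ) < (j : ℕ)),
                r t i : ℕ) : ℝ)))
        Filter.atTop (nhds (θ j)))
    (hθrange : (0 < m ∧ ∀ j, 0 < θ j ∧ θ j < 1) ∨
        (m < 0 ∧ ∀ j, 0 < θ j ∧ θ j < q ^ (-m * ((n : ℤ) - 1)))) :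
    Filter.Tendsto
      (fun t =>
        qMultinom (q ^ (-m)) ((n : ℝ) + (∑ i, w i) - 1) w *
          (q ^ (-m)) ^ (∑ j : Fin k,
              ((n : ℝ) + (∑ i, w i) -
                  ∑ i ∈ Finset.univ.filter (fun i : Fin k => (i : ℕ) ≤ (j : ℕ)), (w i : ℝ)) *
                (-(r t j.castSucc : ℝ) / (m : ℝ) - w j)) *
          ((∏ j : Fin k, qFact (q ^ (-m)) (-(r t j.castSucc : ℝ) / (m : ℝ)) (w j)) *
            qFact (q ^ (-m)) (-(r t (Fin.last k) : ℝ) / (m : ℝ)) n) /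
          qFact (q ^ (-m)) (-((∑ j, r t j : ℕ) : ℝ) / (m : ℝ)) (n + ∑ i, w i))
      Filter.atTop
      (nhds (qMultinom (q ^ m) ((n : ℝ) + (∑ i, w i) - 1) w *
        ∏ j : Fin k,
          θ j ^ (n + (∑ i, w i) -
              ∑ i ∈ Finset.univ.filter (fun i : Fin k => (i : ℕ) ≤ (j : ℕ)), w i) *
            q ^ (m * (w j : ℤ)) *
            ∏ i ∈ Finset.range (w j), (1 - θ j * q ^ (m * (i : ℤ))))) := by
  have hpow := tendsto_pow_atTop_nhds_zero_of_lt_one hq0.le hq1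
  have hQpos : 0 < q ^ (-m) := zpow_pos hq0 _
  have hp1 : q ^ m ≠ 1 := fun h =>
    hm ((zpow_eq_one_iff_right₀ hq0.le hq1.ne).mp h)
  have hQ1 : (1 : ℝ) - q ^ (-m) ≠ 0 := fun h => neg_ne_zero.mpr hm
    ((zpow_eq_one_iff_right₀ hq0.le hq1.ne).mp (sub_eq_zero.mp h).symm)
  simp_rw [sum_sub_sum_filter_lt] at hinf hθ
  have hR : Tendsto (fun t => q ^ (∑ j, r t j)) atTop (nhds 0) :=
    hpow.comp (by simpa using hinf 0 (Nat.zero_le k))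
  have hlast : Tendsto (fun t => q ^ r t (Fin.last k)) atTop (nhds 0) := by
    refine hpow.comp ((hinf k le_rfl).congr fun t => ?_)
    have hf : Finset.univ.filter (fun i : Fin (k + 1) => k ≤ (i : ℕ)) = {Fin.last k} := by
      ext i
      simp only [Finset.mem_filter, Finset.mem_univ, true_and, Finset.mem_singleton, Fin.ext_iff,
        Fin.val_last]
      omega
    rw [hf, Finset.sum_singleton]
  have hr : ∀ j : Fin k, Tendsto (fun t => q ^ r t j.castSucc) atTop (nhds (θ j)) := fun j =>
    tendsto_pow_of_tendsto_qNum_ratio hq0 hq1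
      (fun t => sum_filter_le_eq_succ (r t) j.castSucc)
      (hinf (j + 1) j.isLt) (hinf j j.isLt.le) (hθ j)
  set e : Fin k → ℕ := fun j => n + (∑ i, w i) -
    ∑ i ∈ Finset.univ.filter (fun i : Fin k => (i : ℕ) ≤ (j : ℕ)), w i with he
  have hecast : ∀ j : Fin k, (n : ℝ) + (∑ i, w i : ℕ) -
      ∑ i ∈ Finset.univ.filter (fun i : Fin k => (i : ℕ) ≤ (j : ℕ)), (w i : ℝ) = e j := by
    intro j
    have hle : ∑ i ∈ Finset.univ.filter (fun i : Fin k => (i : ℕ) ≤ (j : ℕ)), w i ≤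
        n + ∑ i, w i :=
      (Finset.sum_le_sum_of_subset (Finset.filter_subset _ _)).trans (Nat.le_add_left _ _)
    rw [he, Nat.cast_sub hle]
    push_cast
    ring
  have hexp : Tendsto (fun t => (q ^ (-m)) ^ (∑ j : Fin k,
      (e j : ℝ) * (-(r t j.castSucc : ℝ) / (m : ℝ) - w j))) atTop
      (nhds (∏ j, (θ j * q ^ (m * (w j : ℤ))) ^ e j)) := by
    simp_rw [Real.rpow_sum_of_pos hQpos, mul_comm (e _ : ℝ), Real.rpow_mul hQpos.le,
      zpow_neg_rpow hq0 hm, Real.rpow_natCast]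
    exact tendsto_finsetProd _ fun j _ => ((hr j).mul_const _).pow _
  have hnum : Tendsto (fun t => (∏ j : Fin k,
        qFact (q ^ (-m)) (-(r t j.castSucc : ℝ) / (m : ℝ)) (w j)) *
      qFact (q ^ (-m)) (-(r t (Fin.last k) : ℝ) / (m : ℝ)) n) atTop _ :=
    (tendsto_finsetProd _ fun j _ => tendsto_qFact hq0 hm (hr j) (w j)).mul
      (tendsto_qFact hq0 hm hlast n)
  have hden := tendsto_qFact hq0 hm hR (n + ∑ i, w i)
  simp only [zero_mul, sub_zero, Finset.prod_const_one] at hnum hden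
  have hmain := ((hexp.const_mul (qMultinom (q ^ (-m)) ((n : ℝ) + (∑ i, w i : ℕ) - 1) w)).mul
    hnum).div hden (one_div_ne_zero (pow_ne_zero _ hQ1))
  have hmulti := qMultinom_inv (zpow_pos hq0 m) hp1 n w
  simp_rw [hecast, Real.rpow_sum_of_pos (zpow_pos hq0 m)] at hmulti
  rw [← zpow_neg] at hmulti
  simp_rw [hecast]
  convert hmain using 2
  · rfl
  rw [hmulti, Finset.prod_div_distrib, Finset.prod_pow_eq_pow_sum]
  have hfac : ∀ j : Fin k, θ j ^ e j * q ^ (m * (w j : ℤ)) *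
        ∏ i ∈ Finset.range (w j), (1 - θ j * q ^ (m * (i : ℤ))) =
      (q ^ m) ^ ((w j : ℝ) * (1 - e j)) * (θ j * q ^ (m * (w j : ℤ))) ^ e j *
        ∏ i ∈ Finset.range (w j), (1 - θ j * q ^ (m * (i : ℤ))) := by
    intro j
    have hz : (q ^ m) ^ ((w j : ℝ) * (1 - e j)) * (q ^ (m * (w j : ℤ))) ^ e j =
        q ^ (m * (w j : ℤ)) := by
      rw [← Real.rpow_intCast, ← Real.rpow_intCast, ← Real.rpow_natCast (_ ^ _),
        ← Real.rpow_mul hq0.le, ← Real.rpow_mul hq0.le, ← Real.rpow_add hq0]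
      congr 1
      push_cast
      ring
    rw [mul_pow, mul_left_comm, hz]
  rw [Finset.prod_congr rfl fun j _ => hfac j, Finset.prod_mul_distrib, Finset.prod_mul_distrib]
  field_simp
  rw [pow_add]
  ring
end
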